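/- The set A = {x ∈ 2^ω : for every n ∈ ω, x is constant on the interval [n², (n+1)²)} satisfies dim_H(A) = 0, but A does not belong to the Yorioka ideal I_id. In particular, the inclusion I_id ⊆ HDZ is strict. -/

import Mathlib

open Set

/-- The Cantor space `2^ω = ℕ → Bool` carries the metric
`d(x,y) = 2^{-min{n : x n ≠ y n}}` (and `d(x,x) = 0`). -/
noncomputable local instance cantorMetric : MetricSpace (ℕ → Bool) := PiNat.metricSpace

/-- `s` is an initial segment of `x : 2^ω`. -/
def InitSeg (s : List Bool) (x : ℕ → Bool) : Prop :=
  ∀ i : ℕ, (hi : i < s.length) → s.get ⟨i, hi⟩ = x i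

/-- `[σ]_∞` : the set of `x ∈ 2^ω` having `σ n` as an initial segment for infinitely
many `n`. -/
def limsupCyl (σ : ℕ → List Bool) : Set (ℕ → Bool) :=
  {x | ∃ᶠ n in Filter.atTop, InitSeg (σ n) x}

/-- The ideal `J_g = {A ⊆ 2^ω : ∃ σ, ht σ = g and A ⊆ [σ]_∞}`. -/
def Jg (g : ℕ → ℕ) : Set (Set (ℕ → Bool)) :=
  {A | ∃ σ : ℕ → List Bool, (∀ n, (σ n).length = g n) ∧ A ⊆ limsupCyl σ}

/-- `f ≪ g` iff for every `k`, `f (n^k) ≤ g n` for all but finitely many `n`. -/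
def FastBelow (f g : ℕ → ℕ) : Prop := ∀ k : ℕ, ∀ᶠ n in Filter.atTop, f (n ^ k) ≤ g n

/-- The Yorioka ideal `I_f = ⋃_{g ≫ f} J_g`. -/
def Yorioka (f : ℕ → ℕ) : Set (Set (ℕ → Bool)) :=
  {A | ∃ g : ℕ → ℕ, FastBelow f g ∧ A ∈ Jg g}

/-- The set of `x ∈ 2^ω` that are constant on every interval `[n², (n+1)²)`. -/
def constOnSquares : Set (ℕ → Bool) :=
  {x | ∀ n i : ℕ, n ^ 2 ≤ i → i < (n + 1) ^ 2 → x i = x (n ^ 2)}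

open MeasureTheory Topology Filter

open scoped ENNReal

theorem ediam_le_of_agree {t : Set (ℕ → Bool)} {m : ℕ}
    (h : ∀ x ∈ t, ∀ y ∈ t, ∀ i < m, x i = y i) :
    Metric.ediam t ≤ (2⁻¹ : ℝ≥0∞) ^ m := by
  refine Metric.ediam_le fun x hx y hy => ?_
  have hd : dist x y ≤ (1 / 2 : ℝ) ^ m :=
    PiNat.mem_cylinder_iff_dist_le.1 fun i hi => h x hx y hy i hi
  calc edist x y = ENNReal.ofReal (dist x y) := edist_dist x y
    _ ≤ ENNReal.ofReal ((1 / 2 : ℝ) ^ m) := ENNReal.ofReal_le_ofReal hd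
    _ = (2⁻¹ : ℝ≥0∞) ^ m := by
      rw [ENNReal.ofReal_pow (by norm_num), one_div, ENNReal.ofReal_inv_of_pos (by norm_num)]
      simp

theorem ediam_rpow_le_of_agree {t : Set (ℕ → Bool)} {m : ℕ} {d : ℝ} (hd : 0 < d)
    (h : ∀ x ∈ t, ∀ y ∈ t, ∀ i < m, x i = y i) :
    Metric.ediam t ^ d ≤ ((2⁻¹ : ℝ≥0∞) ^ d) ^ m := by
  calc Metric.ediam t ^ d ≤ ((2⁻¹ : ℝ≥0∞) ^ m) ^ d :=
        ENNReal.rpow_le_rpow (ediam_le_of_agree h) hd.le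
    _ = ((2⁻¹ : ℝ≥0∞) ^ d) ^ m := by
      rw [← ENNReal.rpow_natCast, ← ENNReal.rpow_natCast, ← ENNReal.rpow_mul,
        ← ENNReal.rpow_mul, mul_comm]

theorem two_inv_rpow_lt_one {d : ℝ} (hd : 0 < d) : (2⁻¹ : ℝ≥0∞) ^ d < 1 :=
  ENNReal.rpow_lt_one (by simp) hd

theorem tendsto_two_inv_pow : Tendsto (fun n : ℕ => (2⁻¹ : ℝ≥0∞) ^ n) atTop (𝓝 0) :=
  ENNReal.tendsto_pow_atTop_nhds_zero_of_lt_one (by simp)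

theorem tendsto_two_pow_mul_pow_sq {q : ℝ≥0∞} (hq : q < 1) :
    Tendsto (fun n : ℕ => 2 ^ n * q ^ n ^ 2) atTop (𝓝 0) := by
  have h := ENNReal.Tendsto.const_mul (a := 2)
    (ENNReal.tendsto_pow_atTop_nhds_zero_of_lt_one hq) (Or.inr (by simp))
  rw [mul_zero] at h
  refine tendsto_of_tendsto_of_tendsto_of_le_of_le' tendsto_const_nhds tendsto_two_inv_pow
    (Eventually.of_forall fun _ => zero_le) ?_
  filter_upwards [h.eventually_lt_const (show (0 : ℝ≥0∞) < 2⁻¹ by simp)] with n hn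
  calc (2 : ℝ≥0∞) ^ n * q ^ n ^ 2 = (2 * q ^ n) ^ n := by rw [mul_pow, ← pow_mul, sq]
    _ ≤ 2⁻¹ ^ n := pow_le_pow_left' hn.le n

theorem dimH_eq_zero_of_hausdorffMeasure_eq_zero {A : Set (ℕ → Bool)}
    (h : ∀ d : ℝ, 0 < d → μH[d] A = 0) : dimH A = 0 := by
  refine le_antisymm (ENNReal.le_of_forall_pos_le_add fun ε hε _ => ?_) zero_le
  rw [zero_add]
  refine dimH_le_of_hausdorffMeasure_ne_top ?_
  rw [h ε (by exact_mod_cast hε)]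
  exact ENNReal.zero_ne_top

theorem eq_apply_sqrt_sq_of_mem {x : ℕ → Bool} (hx : x ∈ constOnSquares) (i : ℕ) :
    x i = x (i.sqrt ^ 2) :=
  hx _ i (Nat.sqrt_le' i) (Nat.lt_succ_sqrt' i)

theorem dimH_constOnSquares : dimH constOnSquares = 0 := by
  refine dimH_eq_zero_of_hausdorffMeasure_eq_zero fun d hd => ?_
  set t : ∀ n : ℕ, (Fin n → Bool) → Set (ℕ → Bool) :=
    fun n c => {x | x ∈ constOnSquares ∧ ∀ k : Fin n, x (k ^ 2) = c k}
  have agree : ∀ n c, ∀ x ∈ t n c, ∀ y ∈ t n c, ∀ i < n ^ 2, x i = y i := by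
    rintro n c x ⟨hx, hxc⟩ y ⟨hy, hyc⟩ i hi
    have hs : i.sqrt < n := Nat.sqrt_lt'.2 hi
    rw [eq_apply_sqrt_sq_of_mem hx, eq_apply_sqrt_sq_of_mem hy, hxc ⟨_, hs⟩, hyc ⟨_, hs⟩]
  have key := Measure.hausdorffMeasure_le_liminf_sum d constOnSquares (l := atTop)
    (fun n : ℕ => (2⁻¹ : ℝ≥0∞) ^ n ^ 2)
    (tendsto_two_inv_pow.comp (tendsto_pow_atTop two_ne_zero)) t
    (Eventually.of_forall fun n c => ediam_le_of_agree (agree n c))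
    (Eventually.of_forall fun n x hx => mem_iUnion.2 ⟨fun k => x (k ^ 2), hx, fun _ => rfl⟩)
  refine le_antisymm (key.trans ?_) zero_le
  rw [← (tendsto_two_pow_mul_pow_sq (two_inv_rpow_lt_one hd)).liminf_eq]
  refine liminf_le_liminf (Eventually.of_forall fun n => ?_)
  calc ∑ c, Metric.ediam (t n c) ^ d ≤ ∑ _c : Fin n → Bool, ((2⁻¹ : ℝ≥0∞) ^ d) ^ n ^ 2 :=
        Finset.sum_le_sum fun c _ => ediam_rpow_le_of_agree hd (agree n c)
    _ = 2 ^ n * ((2⁻¹ : ℝ≥0∞) ^ d) ^ n ^ 2 := by simp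

theorem dimH_eq_zero_of_mem_Yorioka {A : Set (ℕ → Bool)} (hA : A ∈ Yorioka id) :
    dimH A = 0 := by
  obtain ⟨g, hg, σ, hσ, hAσ⟩ := hA
  obtain ⟨N, hN⟩ := eventually_atTop.1 (hg 1)
  simp only [pow_one, id] at hN
  refine dimH_eq_zero_of_hausdorffMeasure_eq_zero fun d hd => ?_
  set t : ℕ → ℕ → Set (ℕ → Bool) := fun n i => {x | InitSeg (σ (i + n)) x} with ht
  have agree : ∀ n ≥ N, ∀ i, ∀ x ∈ t n i, ∀ y ∈ t n i, ∀ j < i + n, x j = y j := by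
    intro n hn i x hx y hy j hj
    have hj' : j < (σ (i + n)).length := by
      rw [hσ]
      exact hj.trans_le (hN _ (by omega))
    exact (hx j hj').symm.trans (hy j hj')
  have key := Measure.hausdorffMeasure_le_liminf_tsum d A (l := atTop)
    (fun n : ℕ => (2⁻¹ : ℝ≥0∞) ^ n) tendsto_two_inv_pow t
    (by
      filter_upwards [eventually_ge_atTop N] with n hn i
      exact ediam_le_of_agree fun x hx y hy j hj => agree n hn i x hx y hy j (by omega))
    (Eventually.of_forall fun n x hx => by
      obtain ⟨m, hm, hmx⟩ := frequently_atTop.1 (hAσ hx) n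
      refine mem_iUnion.2 ⟨m - n, ?_⟩
      simpa only [ht, mem_ofPred_eq, Nat.sub_add_cancel hm] using hmx)
  refine le_antisymm (key.trans ?_) zero_le
  have hq := two_inv_rpow_lt_one hd
  set q : ℝ≥0∞ := 2⁻¹ ^ d
  have lim : Tendsto (fun n : ℕ => (1 - q)⁻¹ * q ^ n) atTop (𝓝 0) := by
    simpa using ENNReal.Tendsto.const_mul (a := (1 - q)⁻¹)
      (ENNReal.tendsto_pow_atTop_nhds_zero_of_lt_one hq)
      (Or.inr (ENNReal.inv_ne_top.2 (tsub_pos_of_lt hq).ne'))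
  rw [← lim.liminf_eq]
  refine liminf_le_liminf ?_
  filter_upwards [eventually_ge_atTop N] with n hn
  calc ∑' i, Metric.ediam (t n i) ^ d ≤ ∑' i, q ^ i * q ^ n :=
        ENNReal.tsum_le_tsum fun i => by
          rw [← pow_add]
          exact ediam_rpow_le_of_agree hd (agree n hn i)
    _ = (1 - q)⁻¹ * q ^ n := by rw [ENNReal.tsum_mul_right, ENNReal.tsum_geometric]

theorem constOnSquares_notMem_Yorioka : constOnSquares ∉ Yorioka id := by
  rintro ⟨g, hg, σ, hσ, hA⟩
  set x : ℕ → Bool := fun i => !((σ i.sqrt).getD (i.sqrt ^ 2) false) with hx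
  have hxA : x ∈ constOnSquares := by
    intro n i h₁ h₂
    have hi : i.sqrt = n := (Nat.eq_sqrt'.2 ⟨h₁, h₂⟩).symm
    simp [hx, hi, Nat.sqrt_eq']
  obtain ⟨n, hn, hg3, h2⟩ :=
    ((hA hxA).and_eventually ((hg 3).and (eventually_ge_atTop 2))).exists
  have hlen : n ^ 2 < (σ n).length := by
    rw [hσ]
    refine lt_of_lt_of_le ?_ hg3
    exact Nat.pow_lt_pow_right h2 (by norm_num)
  have := hn (n ^ 2) hlen
  simp [hx, Nat.sqrt_eq', hlen] at this

/-- The set `A` of `x ∈ 2^ω` that are constant on every interval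
`[n², (n+1)²)` has Hausdorff dimension `0` but does not belong to the Yorioka ideal
`I_id`. In particular the inclusion `I_id ⊆ HDZ` is strict. -/
theorem stmt15 :
    dimH constOnSquares = 0 ∧ constOnSquares ∉ Yorioka id ∧
      Yorioka id ⊂ {A : Set (ℕ → Bool) | dimH A = 0} :=
  ⟨dimH_constOnSquares, constOnSquares_notMem_Yorioka,
    fun _ hA => dimH_eq_zero_of_mem_Yorioka hA,
    fun h => constOnSquares_notMem_Yorioka (h dimH_constOnSquares)⟩
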